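/- arXiv:math/0404359 — 2 statements merged into one kernel-verified Lean document; each statement's English description precedes it below -/
import Mathlib

section
/- Let (X, μ) be a measure space, and let h, φ : X → [0,∞] and f : X → (0,∞) be measurable functions. If ∫_X h φ⁴ dμ ≥ ∫_X f φ⁶ dμ and ∫_X f φ⁶ dμ is finite, then ∫_X h³ f⁻² dμ ≥ ∫_X f φ⁶ dμ. -/
open MeasureTheory ENNReal

/-- Pointwise factorization behind the weighted Hölder inequality. -/
theorem cube_div_sq_rpow_mul_rpow (a b c : ℝ≥0∞) (hc0 : c ≠ 0) (hctop : c ≠ ∞) :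
    (a ^ 3 * (c ^ 2)⁻¹) ^ (1 / 3 : ℝ) * (c * b ^ 6) ^ (2 / 3 : ℝ) = a * b ^ 4 := by
  have ha : (a ^ 3) ^ (1 / 3 : ℝ) = a := by
    rw [← ENNReal.rpow_natCast, ← ENNReal.rpow_mul]
    norm_num
  have hb : (b ^ 6) ^ (2 / 3 : ℝ) = b ^ 4 := by
    rw [← ENNReal.rpow_natCast, ← ENNReal.rpow_mul, ← ENNReal.rpow_natCast]
    norm_num
  have hc : (c ^ 2) ^ (1 / 3 : ℝ) = c ^ (2 / 3 : ℝ) := by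
    rw [← ENNReal.rpow_natCast, ← ENNReal.rpow_mul]
    norm_num
  have hcancel : (c ^ (2 / 3 : ℝ))⁻¹ * c ^ (2 / 3 : ℝ) = 1 :=
    ENNReal.inv_mul_cancel (by simp [hc0, hctop]) (by simp [hc0, hctop])
  rw [ENNReal.mul_rpow_of_nonneg _ _ (by norm_num), ENNReal.mul_rpow_of_nonneg _ _ (by norm_num),
    ENNReal.inv_rpow, ha, hb, hc, mul_assoc, ← mul_assoc _ _ (b ^ 4), hcancel, one_mul]

/-- Cancelling a common factor in a one-third/two-thirds interpolation bound. -/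
theorem le_of_le_rpow_third_mul_rpow_two_thirds {A B : ℝ≥0∞} (hB : B ≠ ∞)
    (hAB : B ≤ A ^ (1 / 3 : ℝ) * B ^ (2 / 3 : ℝ)) : B ≤ A := by
  rcases eq_or_ne B 0 with rfl | hB0
  · exact zero_le
  have hsplit : B ^ (1 / 3 : ℝ) * B ^ (2 / 3 : ℝ) = B := by
    rw [← ENNReal.rpow_add _ _ hB0 hB]
    norm_num
  have hmul : B ^ (1 / 3 : ℝ) * B ^ (2 / 3 : ℝ) ≤ A ^ (1 / 3 : ℝ) * B ^ (2 / 3 : ℝ) :=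
    hsplit.trans_le hAB
  rw [ENNReal.mul_le_mul_iff_left (by simp [hB0, hB]) (by simp [hB0, hB])] at hmul
  exact (ENNReal.rpow_le_rpow_iff (by norm_num)).1 hmul

/-- If `∫ h φ⁴ dμ ≥ ∫ f φ⁶ dμ` and `∫ f φ⁶ dμ` is finite, then
`∫ h³ f⁻² dμ ≥ ∫ f φ⁶ dμ`, as Lebesgue integrals valued in `[0,∞]`. -/
theorem lintegral_cube_div_sq_ge
    {X : Type*} [MeasurableSpace X] (μ : Measure X)
    (h φ f : X → ℝ≥0∞)
    (hh : Measurable h) (hφ : Measurable φ) (hf : Measurable f)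
    (hf0 : ∀ x, 0 < f x) (hftop : ∀ x, f x < ∞)
    (hfin : (∫⁻ x, f x * (φ x) ^ 6 ∂μ) ≠ ∞)
    (hge : (∫⁻ x, h x * (φ x) ^ 4 ∂μ) ≥ ∫⁻ x, f x * (φ x) ^ 6 ∂μ) :
    (∫⁻ x, (h x) ^ 3 * ((f x) ^ 2)⁻¹ ∂μ) ≥ ∫⁻ x, f x * (φ x) ^ 6 ∂μ := by
  refine le_of_le_rpow_third_mul_rpow_two_thirds hfin (hge.le.trans ?_)
  have holder := ENNReal.lintegral_mul_norm_pow_le (μ := μ)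
    (f := fun x => h x ^ 3 * (f x ^ 2)⁻¹) (g := fun x => f x * φ x ^ 6)
    (by fun_prop) (by fun_prop) (p := 1 / 3) (q := 2 / 3)
    (by norm_num) (by norm_num) (by norm_num)
  simpa only [fun x => cube_div_sq_rpow_mul_rpow (h x) (φ x) (f x) (hf0 x).ne' (hftop x).ne]
    using holder
end

section
/- Let (X, μ) be a measure space, and let h, φ : X → [0,∞] and f : X → (0,∞) be measurable functions with ∫_X f φ⁶ dμ finite. If ∫_X h φ⁴ dμ ≥ ∫_X f φ⁶ dμ, then (∫_X f⁴ dμ)^{1/3} · (∫_X h³ f⁻² dμ)^{2/3} ≥ ∫_X f² φ⁴ dμ. -/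
open MeasureTheory ENNReal

/-- A pointwise factorization into powers with exponents `1/3` and `2/3`. -/
lemma ENNReal.mul_pow_four_eq_rpow_mul_rpow {a b c : ℝ≥0∞} (hb0 : b ≠ 0) (hb : b ≠ ∞) :
    (a ^ 3 * (b ^ 2)⁻¹) ^ ((1 : ℝ) / 3) * (b * c ^ 6) ^ ((2 : ℝ) / 3) = a * c ^ 4 := by
  have ha : (a ^ 3) ^ ((1 : ℝ) / 3) = a := by
    rw [← rpow_natCast, ← rpow_mul]; norm_num
  have hc : (c ^ 6) ^ ((2 : ℝ) / 3) = c ^ 4 := by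
    rw [← rpow_natCast, ← rpow_natCast, ← rpow_mul]; norm_num
  have hb2 : (b ^ 2) ^ ((1 : ℝ) / 3) = b ^ ((2 : ℝ) / 3) := by
    rw [← rpow_natCast, ← rpow_mul]; norm_num
  rw [mul_rpow_of_nonneg _ _ (by norm_num), mul_rpow_of_nonneg _ _ (by norm_num), inv_rpow,
    ha, hb2, hc, mul_assoc, ← mul_assoc _ (b ^ ((2 : ℝ) / 3)),
    ENNReal.inv_mul_cancel (by simp [hb0, hb]) (by simp [hb0, hb]), one_mul]

/-- An inequality `c ≤ b ^ (1/3) * c ^ (2/3)` with `c` finite forces `c ≤ b`. -/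
lemma ENNReal.le_of_le_rpow_mul_rpow {b c : ℝ≥0∞} (hc : c ≠ ∞)
    (hbc : c ≤ b ^ ((1 : ℝ) / 3) * c ^ ((2 : ℝ) / 3)) : c ≤ b := by
  rcases eq_or_ne c 0 with rfl | hc0
  · exact zero_le
  have hsplit : c ^ ((1 : ℝ) / 3) * c ^ ((2 : ℝ) / 3) = c := by
    rw [← rpow_add _ _ hc0 hc]; norm_num
  have hle : c ^ ((1 : ℝ) / 3) * c ^ ((2 : ℝ) / 3) ≤ b ^ ((1 : ℝ) / 3) * c ^ ((2 : ℝ) / 3) :=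
    hsplit.le.trans hbc
  rw [ENNReal.mul_le_mul_iff_left (by simp [hc0, hc]) (by simp [hc0, hc])] at hle
  exact (rpow_le_rpow_iff (by norm_num)).1 hle

/-- The analytic content of the rescaling lemma: if `∫ f φ⁶ dμ` is finite
and `∫ h φ⁴ dμ ≥ ∫ f φ⁶ dμ`, then
`(∫ f⁴ dμ)^{1/3} · (∫ h³ f⁻² dμ)^{2/3} ≥ ∫ f² φ⁴ dμ`,
as Lebesgue integrals valued in `[0,∞]`. -/
theorem lintegral_rescaling_lemma
    {X : Type*} [MeasurableSpace X] (μ : Measure X)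
    (h φ f : X → ℝ≥0∞)
    (hh : Measurable h) (hφ : Measurable φ) (hf : Measurable f)
    (hf0 : ∀ x, 0 < f x) (hftop : ∀ x, f x < ∞)
    (hfin : (∫⁻ x, f x * (φ x) ^ 6 ∂μ) ≠ ∞)
    (hge : (∫⁻ x, h x * (φ x) ^ 4 ∂μ) ≥ ∫⁻ x, f x * (φ x) ^ 6 ∂μ) :
    (∫⁻ x, (f x) ^ 4 ∂μ) ^ ((1 : ℝ) / 3) *
        (∫⁻ x, (h x) ^ 3 * ((f x) ^ 2)⁻¹ ∂μ) ^ ((2 : ℝ) / 3) ≥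
      ∫⁻ x, (f x) ^ 2 * (φ x) ^ 4 ∂μ := by
  have hfφ : Measurable fun x ↦ f x * φ x ^ 6 := by fun_prop
  have hhf : Measurable fun x ↦ h x ^ 3 * (f x ^ 2)⁻¹ := by fun_prop
  have hf4 : Measurable fun x ↦ f x ^ 4 := by fun_prop
  have hold_h := lintegral_mul_norm_pow_le (μ := μ) hhf.aemeasurable hfφ.aemeasurable
    (p := 1 / 3) (q := 2 / 3) (by norm_num) (by norm_num) (by norm_num)
  have hold_f := lintegral_mul_norm_pow_le (μ := μ) hf4.aemeasurable hfφ.aemeasurable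
    (p := 1 / 3) (q := 2 / 3) (by norm_num) (by norm_num) (by norm_num)
  simp_rw [fun x ↦ mul_pow_four_eq_rpow_mul_rpow (a := h x) (c := φ x) (hf0 x).ne' (hftop x).ne]
    at hold_h
  have hpt (x : X) : (f x ^ 4) ^ ((1 : ℝ) / 3) * (f x * φ x ^ 6) ^ ((2 : ℝ) / 3)
      = f x ^ 2 * φ x ^ 4 := by
    rw [← mul_pow_four_eq_rpow_mul_rpow (a := f x ^ 2) (c := φ x) (hf0 x).ne' (hftop x).ne]
    congr 2
    rw [← pow_mul, show 2 * 3 = 4 + 2 from rfl, pow_add, mul_assoc,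
      ENNReal.mul_inv_cancel (by simp [(hf0 x).ne']) (by simp [(hftop x).ne]), mul_one]
  simp_rw [hpt] at hold_f
  have hle := le_of_le_rpow_mul_rpow hfin (hge.le.trans hold_h)
  exact hold_f.trans (by gcongr)
end
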